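/- Let (ℋ, μ) be a linear classification problem with hard core 𝒞 and let φ ∈ Φ. Then there exists a sequence {λ_i} ⊂ ℝⁿ such that y(Hλ_i)(x) = 0 for μ-a.e. (x,y) ∈ 𝒞 and φ(−y(Hλ_i)(x)) → 0 for μ-a.e. (x,y) ∈ 𝒞^c; consequently R_{φ;𝒞^c}(span(ℋ)) = 0 and R_φ(span(ℋ)) = R_{φ;𝒞}(span(ℋ)). -/

import Mathlib

open MeasureTheory Filter

section HardCore

open Topology Set

variable {Ω E : Type*} [MeasurableSpace Ω]

lemma ae_abs_le_of_memLp_top {ν : Measure Ω} {f : Ω → ℝ} (hf : MemLp f ⊤ ν) :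
    ∃ b : ℝ, ∀ᵐ z ∂ν, |f z| ≤ b := by
  refine ⟨(eLpNorm f ⊤ ν).toReal, ?_⟩
  filter_upwards [ae_le_eLpNormEssSup (f := f) (μ := ν)] with z hz
  rw [← eLpNorm_exponent_top] at hz
  have := ENNReal.toReal_mono hf.2.ne hz
  simpa using this

lemma integrable_continuous_comp_of_memLp_top {ν : Measure Ω} [IsFiniteMeasure ν] {φ : ℝ → ℝ}
    (hφ : Continuous φ) {f : Ω → ℝ} (hf : MemLp f ⊤ ν) : Integrable (fun z => φ (f z)) ν := by
  obtain ⟨b, hb⟩ := ae_abs_le_of_memLp_top hf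
  obtain ⟨c, hc⟩ := (isCompact_Icc (a := -b) (b := b)).exists_bound_of_continuousOn
    hφ.continuousOn
  refine Integrable.of_bound (hφ.comp_aestronglyMeasurable hf.1) c ?_
  filter_upwards [hb] with z hz
  exact hc _ (abs_le.1 hz)

lemma continuous_of_convexOn_univ {φ : ℝ → ℝ} (hφ : ConvexOn ℝ univ φ) : Continuous φ :=
  hφ.locallyLipschitz.continuous

lemma ConvexOn.monotone_of_tendsto_atBot_zero {φ : ℝ → ℝ} (hφ : ConvexOn ℝ univ φ)
    (hlim : Tendsto φ atBot (𝓝 0)) : Monotone φ := by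
  intro a b hab
  by_contra! hlt
  have hne : a < b := lt_of_le_of_ne hab (by rintro rfl; exact lt_irrefl _ hlt)
  have hle : ∀ᶠ t in atBot, φ a + (φ a - φ b) / (b - a) * (a - t) ≤ φ t := by
    filter_upwards [eventually_lt_atBot a] with t ht
    have := hφ.slope_mono_adjacent (mem_univ t) (mem_univ b) ht hne
    rw [div_le_div_iff₀ (by linarith) (by linarith)] at this
    rw [div_mul_eq_mul_div, ← le_sub_iff_add_le', div_le_iff₀ (by linarith)]
    linarith
  have htop : Tendsto (fun t : ℝ => φ a + (φ a - φ b) / (b - a) * (a - t)) atBot atTop := by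
    refine tendsto_atTop_add_const_left _ _ (Tendsto.const_mul_atTop ?_ ?_)
    · exact div_pos (by linarith) (by linarith)
    · exact tendsto_atTop_add_const_left _ a tendsto_neg_atBot_atTop
  exact not_tendsto_nhds_of_tendsto_atTop (tendsto_atTop_mono' _ hle htop) 0 hlim

section Linear

variable [NormedAddCommGroup E] [NormedSpace ℝ E]

lemma convexOn_integral_comp_neg {ν : Measure Ω} [IsFiniteMeasure ν] {φ : ℝ → ℝ}
    (hφ : ConvexOn ℝ univ φ) {F : E →ₗ[ℝ] Ω → ℝ} (hF : ∀ x, MemLp (F x) ⊤ ν) :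
    ConvexOn ℝ univ fun x => ∫ z, φ (-F x z) ∂ν := by
  have hint : ∀ x, Integrable (fun z => φ (-F x z)) ν := fun x =>
    integrable_continuous_comp_of_memLp_top (continuous_of_convexOn_univ hφ) (hF x).neg
  refine ⟨convex_univ, fun x _ y _ a b ha hb hab => ?_⟩
  simp only [smul_eq_mul]
  rw [← integral_const_mul, ← integral_const_mul,
    ← integral_add ((hint x).const_mul a) ((hint y).const_mul b)]
  refine integral_mono (hint _) (((hint x).const_mul a).add ((hint y).const_mul b)) fun z => ?_
  have := hφ.2 (mem_univ (-F x z)) (mem_univ (-F y z)) ha hb hab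
  simp only [smul_eq_mul] at this
  convert this using 2
  simp
  ring

lemma continuous_integral_comp_neg [FiniteDimensional ℝ E] {ν : Measure Ω} [IsFiniteMeasure ν]
    {φ : ℝ → ℝ} (hφ : ConvexOn ℝ univ φ) {F : E →ₗ[ℝ] Ω → ℝ} (hF : ∀ x, MemLp (F x) ⊤ ν) :
    Continuous fun x => ∫ z, φ (-F x z) ∂ν :=
  (convexOn_integral_comp_neg hφ hF).locallyLipschitz.continuous

lemma convexOn_max_zero : ConvexOn ℝ univ fun t : ℝ => max t 0 :=
  (convexOn_id convex_univ).sup (convexOn_const 0 convex_univ)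

/-- If no nonzero `F x` is almost everywhere nonnegative, the exponential risk has a minimizer. -/
lemma exists_forall_integral_exp_neg_le [FiniteDimensional ℝ E] {ν : Measure Ω}
    [IsFiniteMeasure ν] {F : E →ₗ[ℝ] Ω → ℝ} (hF : ∀ x, MemLp (F x) ⊤ ν)
    (hpos : ∀ x, (∀ᵐ z ∂ν, 0 ≤ F x z) → x = 0) :
    ∃ x, ∀ y, ∫ z, Real.exp (-F x z) ∂ν ≤ ∫ z, Real.exp (-F y z) ∂ν := by
  have hcont := continuous_integral_comp_neg convexOn_exp hF
  have hgcont := continuous_integral_comp_neg convexOn_max_zero hF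
  have hgint : ∀ x, Integrable (fun z => max (-F x z) 0) ν := fun x =>
    integrable_continuous_comp_of_memLp_top (continuous_of_convexOn_univ convexOn_max_zero)
      (hF x).neg
  have heint : ∀ x, Integrable (fun z => Real.exp (-F x z)) ν := fun x =>
    integrable_continuous_comp_of_memLp_top Real.continuous_exp (hF x).neg
  have hgpos : ∀ x, x ≠ 0 → 0 < ∫ z, max (-F x z) 0 ∂ν := by
    intro x hx
    refine lt_of_le_of_ne (integral_nonneg fun z => le_max_right _ _) fun h => hx (hpos x ?_)
    have := (integral_eq_zero_iff_of_nonneg (fun z => le_max_right (-F x z) 0) (hgint x)).1 h.symm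
    filter_upwards [this] with z hz
    have hz' : max (-F x z) 0 = 0 := hz
    linarith [max_eq_right_iff.1 hz']
  obtain ⟨c, hc, hcle⟩ : ∃ c > 0, ∀ x ∈ Metric.sphere (0 : E) 1, c ≤ ∫ z, max (-F x z) 0 ∂ν := by
    rcases (Metric.sphere (0 : E) 1).eq_empty_or_nonempty with he | hne
    · exact ⟨1, one_pos, by simp [he]⟩
    · obtain ⟨x, hx, hmin⟩ := (isCompact_sphere (0 : E) 1).exists_isMinOn hne hgcont.continuousOn
      exact ⟨_, hgpos x (by rintro rfl; simp at hx), fun y hy => hmin hy⟩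
  have hle : ∀ x, c * ‖x‖ ≤ ∫ z, Real.exp (-F x z) ∂ν := by
    intro x
    have h1 : c * ‖x‖ ≤ ∫ z, max (-F x z) 0 ∂ν := by
      rcases eq_or_ne x 0 with rfl | hx
      · simp
      · have hn : 0 < ‖x‖ := norm_pos_iff.2 hx
        have := hcle (‖x‖⁻¹ • x) (by simp [norm_smul, hn.ne'])
        have h2 : ∀ z, max (-F (‖x‖⁻¹ • x) z) 0 = ‖x‖⁻¹ * max (-F x z) 0 := fun z => by
          rw [mul_max_of_nonneg _ _ (inv_nonneg.2 hn.le)]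
          simp
        simp only [h2, integral_const_mul] at this
        rwa [← div_eq_inv_mul, le_div_iff₀ hn] at this
    refine h1.trans (integral_mono (hgint x) (heint x) fun z => max_le ?_ (Real.exp_pos _).le)
    linarith [Real.add_one_le_exp (-F x z)]
  refine hcont.exists_forall_le ?_
  exact tendsto_atTop_mono hle (tendsto_norm_cocompact_atTop.const_mul_atTop hc)

lemma integral_mul_exp_neg_eq_zero_of_forall_le {ν : Measure Ω} [IsFiniteMeasure ν]
    {F : E →ₗ[ℝ] Ω → ℝ} (hF : ∀ x, MemLp (F x) ⊤ ν) {x : E}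
    (hx : ∀ y, ∫ z, Real.exp (-F x z) ∂ν ≤ ∫ z, Real.exp (-F y z) ∂ν) (y : E) :
    ∫ z, F y z * Real.exp (-F x z) ∂ν = 0 := by
  obtain ⟨b, hb⟩ := ae_abs_le_of_memLp_top (hF x)
  obtain ⟨c, hc⟩ := ae_abs_le_of_memLp_top (hF y)
  have heint : ∀ x, Integrable (fun z => Real.exp (-F x z)) ν := fun x =>
    integrable_continuous_comp_of_memLp_top Real.continuous_exp (hF x).neg
  have hder := hasDerivAt_integral_of_dominated_loc_of_deriv_le (μ := ν) (x₀ := (0 : ℝ))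
    (F := fun t z => Real.exp (-F (x + t • y) z))
    (F' := fun t z => Real.exp (-F (x + t • y) z) * -F y z)
    (bound := fun _ => Real.exp (b + c) * c) (Metric.ball_mem_nhds (0 : ℝ) one_pos)
    (Eventually.of_forall fun t => (heint _).1) (heint _)
    ((heint _).1.mul (hF y).1.neg) ?_ (integrable_const _) ?_
  · have hmin : IsLocalMin (fun t : ℝ => ∫ z, Real.exp (-F (x + t • y) z) ∂ν) 0 :=
      Eventually.of_forall fun t => by simpa using hx (x + t • y)
    have := hmin.hasDerivAt_eq_zero hder.2
    simp only [zero_smul, add_zero, mul_neg, integral_neg, neg_eq_zero] at this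
    simpa only [mul_comm] using this
  · filter_upwards [hb, hc] with z hbz hcz t ht
    have ht' : |t| < 1 := by simpa using ht
    have h2 : |t * F y z| ≤ c := by
      rw [abs_mul]
      nlinarith [abs_nonneg t, abs_nonneg (F y z)]
    rw [norm_mul, norm_neg, Real.norm_eq_abs, Real.norm_eq_abs, Real.abs_exp]
    refine mul_le_mul (Real.exp_le_exp.2 ?_) hcz (abs_nonneg _) (Real.exp_pos _).le
    simp only [map_add, map_smul, Pi.add_apply, Pi.smul_apply, smul_eq_mul]
    linarith [neg_abs_le (F x z), neg_abs_le (t * F y z)]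
  · refine Eventually.of_forall fun z t _ => ?_
    refine HasDerivAt.exp ?_
    simp only [map_add, map_smul, Pi.add_apply, Pi.smul_apply, smul_eq_mul]
    simpa using (((hasDerivAt_id t).mul_const (F y z)).const_add (F x z)).fun_neg

/-- The submodule of parameters whose function vanishes almost everywhere. -/
def aeKer (F : E →ₗ[ℝ] Ω → ℝ) (ν : Measure Ω) : Submodule ℝ E where
  carrier := {x | ∀ᵐ z ∂ν, F x z = 0}
  zero_mem' := by simp
  add_mem' {x y} hx hy := by
    simp only [mem_ofPred_eq] at hx hy ⊢
    filter_upwards [hx, hy] with z h1 h2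
    simp [h1, h2]
  smul_mem' c x hx := by
    simp only [mem_ofPred_eq] at hx ⊢
    filter_upwards [hx] with z h1
    simp [h1]

lemma mem_aeKer {F : E →ₗ[ℝ] Ω → ℝ} {ν : Measure Ω} {x : E} :
    x ∈ aeKer F ν ↔ ∀ᵐ z ∂ν, F x z = 0 := Iff.rfl

/-- An almost everywhere version of Stiemke's theorem of the alternative. -/
lemma exists_forall_integral_mul_exp_neg_eq_zero [FiniteDimensional ℝ E] {ν : Measure Ω}
    [IsFiniteMeasure ν] {F : E →ₗ[ℝ] Ω → ℝ} (hF : ∀ x, MemLp (F x) ⊤ ν)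
    (hpos : ∀ x, (∀ᵐ z ∂ν, 0 ≤ F x z) → ∀ᵐ z ∂ν, F x z = 0) :
    ∃ x, ∀ y, ∫ z, F y z * Real.exp (-F x z) ∂ν = 0 := by
  obtain ⟨M, hM⟩ := (aeKer F ν).exists_isCompl
  have hFM : ∀ x : M, MemLp ((F ∘ₗ M.subtype) x) ⊤ ν := fun x => hF x
  obtain ⟨x, hx⟩ := exists_forall_integral_exp_neg_le (F := F ∘ₗ M.subtype) hFM fun x hx =>
    Subtype.ext ((Submodule.disjoint_def.1 hM.disjoint) x (hpos x hx) x.2)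
  refine ⟨x, fun y => ?_⟩
  obtain ⟨u, hu, m, hm, rfl⟩ := Submodule.mem_sup.1
    (hM.sup_eq_top ▸ Submodule.mem_top : y ∈ aeKer F ν ⊔ M)
  rw [← integral_mul_exp_neg_eq_zero_of_forall_le hFM hx ⟨m, hm⟩]
  refine integral_congr_ae ?_
  filter_upwards [mem_aeKer.1 hu] with z hz
  simp [hz]

variable {μ : Measure Ω} [IsFiniteMeasure μ]

/-- Outside a maximal decorrelating support, some direction separates any non-null set
without affecting the support. -/
lemma exists_separating_direction [FiniteDimensional ℝ E] {F : E →ₗ[ℝ] Ω → ℝ}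
    (hF : ∀ x, MemLp (F x) ⊤ μ) {p : Ω → ℝ} (hpint : Integrable p μ) (hpnn : ∀ z, 0 ≤ p z)
    (hdec : ∀ x, ∫ z, F x z * p z ∂μ = 0)
    (hmax : ∀ q : Ω → ℝ, Integrable q μ → (∀ z, 0 ≤ q z) → (∀ x, ∫ z, F x z * q z ∂μ = 0) →
      μ ({z | 0 < q z} \ {z | 0 < p z}) = 0)
    {S : Set Ω} (hS : NullMeasurableSet S μ) (hSp : S ⊆ {z | 0 < p z}ᶜ) (hS0 : μ S ≠ 0) :
    ∃ x, (∀ᵐ z ∂μ.restrict {z | 0 < p z}, F x z = 0) ∧ (∀ᵐ z ∂μ.restrict S, 0 ≤ F x z) ∧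
      ¬ ∀ᵐ z ∂μ.restrict S, F x z = 0 := by
  by_contra! hcon
  have hC : NullMeasurableSet {z | 0 < p z} μ :=
    hpint.1.aemeasurable.nullMeasurable measurableSet_Ioi
  set C := {z | 0 < p z}
  have hT : NullMeasurableSet (C ∪ S) μ := hC.union hS
  have hkey : ∀ x, (∀ᵐ z ∂μ.restrict C, 0 ≤ F x z) → ∀ᵐ z ∂μ.restrict C, F x z = 0 := by
    intro x hx
    obtain ⟨b, hb⟩ := ae_abs_le_of_memLp_top (hF x)
    have hint : Integrable (fun z => F x z * p z) μ := hpint.bdd_mul (hF x).1 hb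
    rw [ae_restrict_iff'₀ hC] at hx ⊢
    have hnn : 0 ≤ᵐ[μ] fun z => F x z * p z := by
      filter_upwards [hx] with z hz
      by_cases h : z ∈ C
      · exact mul_nonneg (hz h) (hpnn z)
      · have : p z = 0 := le_antisymm (not_lt.1 h) (hpnn z)
        simp [this]
    filter_upwards [(integral_eq_zero_iff_of_nonneg_ae hnn hint).1 (hdec x)] with z hz hzC
    exact (mul_eq_zero.1 hz).resolve_right (ne_of_gt hzC)
  obtain ⟨x, hx⟩ := exists_forall_integral_mul_exp_neg_eq_zero (ν := μ.restrict (C ∪ S))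
    (F := F) (fun x => (hF x).restrict _) fun x hx => by
      have hxC : ∀ᵐ z ∂μ.restrict C, F x z = 0 :=
        hkey x (ae_restrict_of_ae_restrict_of_subset subset_union_left hx)
      have hxS := hcon x hxC (ae_restrict_of_ae_restrict_of_subset subset_union_right hx)
      exact (ae_restrict_union_iff _ _ _).2 ⟨hxC, hxS⟩
  have hq := hmax ((C ∪ S).indicator fun z => Real.exp (-F x z))
    ((integrable_continuous_comp_of_memLp_top Real.continuous_exp (hF x).neg).indicator₀ hT)
    (fun z => indicator_nonneg (fun z _ => (Real.exp_pos _).le) z) fun y => by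
      rw [← hx y, ← integral_indicator₀ hT]
      refine integral_congr_ae (Eventually.of_forall fun z => ?_)
      by_cases h : z ∈ C ∪ S <;> simp [indicator, h]
  refine hS0 (measure_mono_null (fun z hz => mem_sdiff_of_mem ?_ (hSp hz)) hq)
  change 0 < (C ∪ S).indicator (fun z => Real.exp (-F x z)) z
  rw [indicator_of_mem (mem_union_right C hz)]
  exact Real.exp_pos _

lemma exists_integral_lt_of_aeKer_eq [FiniteDimensional ℝ E] {F : E →ₗ[ℝ] Ω → ℝ}
    (hF : ∀ x, MemLp (F x) ⊤ μ) {C : Set Ω}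
    (hsep : ∀ S : Set Ω, NullMeasurableSet S μ → S ⊆ Cᶜ → μ S ≠ 0 →
      ∃ x, (∀ᵐ z ∂μ.restrict C, F x z = 0) ∧ (∀ᵐ z ∂μ.restrict S, 0 ≤ F x z) ∧
        ¬ ∀ᵐ z ∂μ.restrict S, F x z = 0)
    {φ : ℝ → ℝ} (hφ : ConvexOn ℝ univ φ) (hlim : Tendsto φ atBot (𝓝 0)) (x₀ : E) {ε : ℝ}
    (hε : 0 < ε) (N : Submodule ℝ E) :
    ∀ S : Set Ω, NullMeasurableSet S μ → S ⊆ Cᶜ → aeKer F (μ.restrict S) = N →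
      ∃ x, (∀ᵐ z ∂μ.restrict C, F x z = 0) ∧ ∫ z in S, φ (-F (x₀ + x) z) ∂μ < ε := by
  have hmono := hφ.monotone_of_tendsto_atBot_zero hlim
  have hnn : ∀ t, 0 ≤ φ t := fun t => hmono.le_of_tendsto hlim t
  have hφc := continuous_of_convexOn_univ hφ
  induction N using WellFoundedGT.induction with
  | ind N ih =>
  intro S hS hSC hN
  by_cases hS0 : μ S = 0
  · exact ⟨0, by simp, by simpa [Measure.restrict_eq_zero.2 hS0] using hε⟩
  obtain ⟨u, huC, huS, hu0⟩ := hsep S hS hSC hS0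
  have hZ : NullMeasurableSet {z | F u z = 0} μ :=
    (hF u).1.aemeasurable.nullMeasurable (measurableSet_singleton 0)
  have hZS : NullMeasurableSet {z | F u z = 0} (μ.restrict S) := hZ.mono_ac
    Measure.absolutelyContinuous_restrict
  have hrestr : (μ.restrict S).restrict {z | F u z = 0} = μ.restrict ({z | F u z = 0} ∩ S) :=
    Measure.restrict_restrict₀ hZS
  have hlt : N < aeKer F (μ.restrict ({z | F u z = 0} ∩ S)) := by
    refine lt_of_le_of_ne ?_ ?_
    · rw [← hN]
      exact fun x hx => ae_restrict_of_ae_restrict_of_subset inter_subset_right hx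
    · intro h
      refine hu0 (mem_aeKer.1 ?_)
      rw [hN, h, mem_aeKer, ← hrestr]
      exact (ae_restrict_iff'₀ hZS).2 (Eventually.of_forall fun z hz => hz)
  obtain ⟨x, hxC, hx⟩ := ih _ hlt _ (hZ.inter hS) (inter_subset_right.trans hSC) rfl
  have hint : ∀ y, Integrable (fun z => φ (-F y z)) (μ.restrict S) := fun y =>
    integrable_continuous_comp_of_memLp_top hφc ((hF y).restrict S).neg
  have hev : ∀ (k : ℕ) z, F (x₀ + (x + (k : ℝ) • u)) z = F (x₀ + x) z + k * F u z := by
    intro k z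
    simp [add_assoc]
  have htend : Tendsto (fun k : ℕ => ∫ z in S, φ (-F (x₀ + (x + (k : ℝ) • u)) z) ∂μ) atTop
      (𝓝 (∫ z in S, {z | F u z = 0}.indicator (fun z => φ (-F (x₀ + x) z)) z ∂μ)) := by
    refine tendsto_integral_of_dominated_convergence (fun z => φ (-F (x₀ + x) z))
      (fun k => (hint _).1) (hint _) (fun k => ?_) ?_
    · filter_upwards [huS] with z hz
      rw [Real.norm_eq_abs, abs_of_nonneg (hnn _), hev]
      exact hmono (by nlinarith [mul_nonneg k.cast_nonneg hz])
    · filter_upwards [huS] with z hz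
      simp only [hev]
      by_cases h : F u z = 0
      · simp [indicator, h]
      · have hpos : 0 < F u z := lt_of_le_of_ne hz (Ne.symm h)
        simp only [indicator, mem_ofPred_eq, h, if_false]
        refine hlim.comp (tendsto_neg_atTop_atBot.comp (tendsto_atTop_add_const_left _ _ ?_))
        exact tendsto_natCast_atTop_atTop.atTop_mul_const hpos
  rw [integral_indicator₀ hZS, hrestr] at htend
  obtain ⟨k, hk⟩ := (htend.eventually (gt_mem_nhds hx)).exists
  refine ⟨x + (k : ℝ) • u, ?_, hk⟩
  filter_upwards [hxC, huC] with z h1 h2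
  simp [h1, h2]

end Linear

lemma exists_seq_tendsto_ae_zero_of_integral {ν : Measure Ω} {g : ℕ → Ω → ℝ}
    (hg : ∀ i, Integrable (g i) ν) (hnn : ∀ i z, 0 ≤ g i z)
    (hlim : Tendsto (fun i => ∫ z, g i z ∂ν) atTop (𝓝 0)) :
    ∃ ns : ℕ → ℕ, ∀ᵐ z ∂ν, Tendsto (fun i => g (ns i) z) atTop (𝓝 0) := by
  have hmeas : TendstoInMeasure ν g atTop (fun _ => (0 : ℝ)) := by
    refine tendstoInMeasure_of_tendsto_eLpNorm one_ne_zero (fun i => (hg i).1)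
      aestronglyMeasurable_const ?_
    have h : ∀ i, eLpNorm (g i - fun _ => (0 : ℝ)) 1 ν = ENNReal.ofReal (∫ z, g i z ∂ν) := by
      intro i
      have : (g i - fun _ => (0 : ℝ)) = g i := by ext; simp
      rw [this, eLpNorm_one_eq_lintegral_enorm, ← ofReal_integral_norm_eq_lintegral_enorm (hg i)]
      simp [abs_of_nonneg (hnn i _)]
    simp only [h]
    simpa using ENNReal.tendsto_ofReal hlim
  obtain ⟨ns, -, hns⟩ := hmeas.exists_seq_tendsto_ae
  exact ⟨ns, hns⟩

/-- The linear map sending a weight vector to its margin function. -/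
def marginMap {X : Type*} {n : ℕ} (h : Fin n → X → ℝ) : (Fin n → ℝ) →ₗ[ℝ] X × ℝ → ℝ where
  toFun lam z := z.2 * ∑ j, lam j * h j z.1
  map_add' x y := by
    ext z
    simp [add_mul, Finset.sum_add_distrib, mul_add]
  map_smul' c x := by
    ext z
    simp [mul_assoc, Finset.mul_sum, mul_left_comm]

lemma memLp_top_marginMap {X : Type*} [MeasurableSpace X] {μ : Measure (X × ℝ)} {n : ℕ}
    {h : Fin n → X → ℝ} (hmeas : ∀ i, Measurable (h i)) (hbd : ∀ i x, |h i x| ≤ 1)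
    (hlabel : ∀ᵐ z ∂μ, z.2 = 1 ∨ z.2 = -1) (lam : Fin n → ℝ) :
    MemLp (marginMap h lam) ⊤ μ := by
  have hm : Measurable (marginMap h lam) := by
    change Measurable fun z : X × ℝ => z.2 * ∑ j, lam j * h j z.1
    fun_prop
  refine memLp_top_of_bound hm.aestronglyMeasurable (∑ j, |lam j|) ?_
  filter_upwards [hlabel] with z hz
  have hz' : |z.2| = 1 := by rcases hz with hz | hz <;> simp [hz]
  change |z.2 * ∑ j, lam j * h j z.1| ≤ _
  rw [abs_mul, hz', one_mul]
  refine (Finset.abs_sum_le_sum_abs _ _).trans (Finset.sum_le_sum fun j _ => ?_)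
  rw [abs_mul]
  exact mul_le_of_le_one_right (abs_nonneg _) (hbd j _)

end HardCore

open MeasureTheory Filter

theorem hard_core_true_risk_structure
    {X : Type*} [MeasurableSpace X]
    (μ : Measure (X × ℝ)) [IsProbabilityMeasure μ]
    (n : ℕ) (h : Fin n → X → ℝ)
    (hmeas : ∀ i, Measurable (h i)) (hbd : ∀ i x, |h i x| ≤ 1)
    (hlabel : ∀ᵐ z ∂μ, z.2 = 1 ∨ z.2 = -1)
    (p : X × ℝ → ℝ)
    (hpint : Integrable p μ) (hpnn : ∀ z, 0 ≤ p z)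
    (hdec : ∀ lam : Fin n → ℝ,
      ∫ z, z.2 * (∑ j, lam j * h j z.1) * p z ∂μ = 0)
    (hmax : ∀ q : X × ℝ → ℝ,
      Integrable q μ → (∀ z, 0 ≤ q z) →
      (∀ lam : Fin n → ℝ,
        ∫ z, z.2 * (∑ j, lam j * h j z.1) * q z ∂μ = 0) →
      μ ({z | 0 < q z} \ {z | 0 < p z}) = 0)
    (φ : ℝ → ℝ) (hconv : ConvexOn ℝ Set.univ φ) (h0 : 0 < φ 0)
    (hlim : Tendsto φ atBot (nhds 0)) :
    (∃ lam : ℕ → Fin n → ℝ,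
      (∀ᵐ z ∂μ, z ∈ {z | 0 < p z} → ∀ i, z.2 * (∑ j, lam i j * h j z.1) = 0) ∧
      (∀ᵐ z ∂μ, z ∈ {z | 0 < p z}ᶜ →
        Tendsto (fun i => φ (-(z.2 * ∑ j, lam i j * h j z.1))) atTop (nhds 0))) ∧
    (⨅ lam : Fin n → ℝ,
        ∫ z in {z | 0 < p z}ᶜ, φ (-(z.2 * ∑ j, lam j * h j z.1)) ∂μ) = 0 ∧
    (⨅ lam : Fin n → ℝ, ∫ z, φ (-(z.2 * ∑ j, lam j * h j z.1)) ∂μ)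
      = ⨅ lam : Fin n → ℝ,
          ∫ z in {z | 0 < p z}, φ (-(z.2 * ∑ j, lam j * h j z.1)) ∂μ := by
  have hF := memLp_top_marginMap hmeas hbd hlabel
  change (∃ lam : ℕ → Fin n → ℝ,
      (∀ᵐ z ∂μ, z ∈ {z | 0 < p z} → ∀ i, marginMap h (lam i) z = 0) ∧
      (∀ᵐ z ∂μ, z ∈ {z | 0 < p z}ᶜ →
        Tendsto (fun i => φ (-marginMap h (lam i) z)) atTop (nhds 0))) ∧
    (⨅ lam : Fin n → ℝ, ∫ z in {z | 0 < p z}ᶜ, φ (-marginMap h lam z) ∂μ) = 0 ∧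
    (⨅ lam : Fin n → ℝ, ∫ z, φ (-marginMap h lam z) ∂μ)
      = ⨅ lam : Fin n → ℝ, ∫ z in {z | 0 < p z}, φ (-marginMap h lam z) ∂μ
  have hC : NullMeasurableSet {z | 0 < p z} μ :=
    hpint.1.aemeasurable.nullMeasurable measurableSet_Ioi
  have hcore : ∀ x₀ : Fin n → ℝ, ∀ ε > 0, ∃ x,
      (∀ᵐ z ∂μ.restrict {z | 0 < p z}, marginMap h x z = 0) ∧
        ∫ z in {z | 0 < p z}ᶜ, φ (-marginMap h (x₀ + x) z) ∂μ < ε := fun x₀ ε hε =>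
    exists_integral_lt_of_aeKer_eq hF
      (fun S hS hSp hS0 => exists_separating_direction hF hpint hpnn hdec hmax hS hSp hS0)
      hconv hlim x₀ hε _ _ hC.compl subset_rfl rfl
  set C := {z | 0 < p z}
  have hnn : ∀ t, 0 ≤ φ t := (hconv.monotone_of_tendsto_atBot_zero hlim).le_of_tendsto hlim
  have hint : ∀ x, Integrable (fun z => φ (-marginMap h x z)) μ := fun x =>
    integrable_continuous_comp_of_memLp_top (continuous_of_convexOn_univ hconv) (hF x).neg
  have hbdd : ∀ ν : Measure (X × ℝ),
      BddBelow (Set.range fun x : Fin n → ℝ => ∫ z, φ (-marginMap h x z) ∂ν) := fun ν =>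
    ⟨0, by rintro _ ⟨x, rfl⟩; exact integral_nonneg fun z => hnn _⟩
  refine ⟨?_, ?_, ?_⟩
  · choose x hx using fun i : ℕ => hcore 0 (1 / ((i : ℝ) + 1)) Nat.one_div_pos_of_nat
    simp only [zero_add] at hx
    obtain ⟨ns, hns⟩ := exists_seq_tendsto_ae_zero_of_integral
      (fun i => (hint (x i)).restrict (s := Cᶜ)) (fun i z => hnn _)
      (squeeze_zero (fun i => integral_nonneg fun z => hnn _) (fun i => (hx i).2.le)
        tendsto_one_div_add_atTop_nhds_zero_nat)
    refine ⟨fun i => x (ns i), (ae_restrict_iff'₀ hC).1 ?_, (ae_restrict_iff'₀ hC.compl).1 hns⟩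
    exact ae_all_iff.2 fun i => (hx (ns i)).1
  · refine le_antisymm (le_of_forall_pos_lt_add fun ε hε => ?_)
      (le_ciInf fun x => integral_nonneg fun z => hnn _)
    obtain ⟨x, -, hx⟩ := hcore 0 ε hε
    rw [zero_add] at hx ⊢
    exact (ciInf_le (hbdd _) x).trans_lt hx
  · refine le_antisymm (le_ciInf fun y => le_of_forall_pos_lt_add fun ε hε => ?_)
      (le_ciInf fun y => (ciInf_le (hbdd _) y).trans
        (setIntegral_le_integral (hint y) (Eventually.of_forall fun z => hnn _)))
    obtain ⟨x, hxC, hx⟩ := hcore y ε hε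
    refine (ciInf_le (hbdd _) (y + x)).trans_lt ?_
    rw [← integral_add_compl₀ hC (hint (y + x))]
    refine add_lt_add_of_le_of_lt (le_of_eq (integral_congr_ae ?_)) hx
    filter_upwards [hxC] with z hz
    simp [hz]
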